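/- Let G be a simple undirected graph on N vertices in which every vertex has positive degree, let α ≥ 0, δ ≥ 0 satisfy α + (δ/2)·(1 − d_min/d_max) ≤ 1, where d_min and d_max are the minimum and maximum degrees, and let W = (α+δ)·Δ⁻¹·(A∘A² + A)·Δ⁻¹ − (δ/2)·(Δ⁻¹·A + A·Δ⁻¹). Then for every vertex i, the off-diagonal row sum satisfies Σ_{k ≠ i} w_{ik} ≤ 1. -/

import Mathlib

open Matrix Finset

/-- The LCP matrix `W = (α+δ)·Δ⁻¹·(A∘A² + A)·Δ⁻¹ − (δ/2)·(Δ⁻¹·A + A·Δ⁻¹)`. -/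
noncomputable def lcpW {N : ℕ} (G : SimpleGraph (Fin N)) [DecidableRel G.Adj] (α δ : ℝ) :
    Matrix (Fin N) (Fin N) ℝ :=
  (α + δ) • ((Matrix.diagonal fun i => (G.degree i : ℝ))⁻¹ *
      (Matrix.hadamard (G.adjMatrix ℝ) (G.adjMatrix ℝ ^ 2) + G.adjMatrix ℝ) *
      (Matrix.diagonal fun i => (G.degree i : ℝ))⁻¹) -
    (δ / 2) • ((Matrix.diagonal fun i => (G.degree i : ℝ))⁻¹ * G.adjMatrix ℝ +
      G.adjMatrix ℝ * (Matrix.diagonal fun i => (G.degree i : ℝ))⁻¹)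

/-- Adjacent vertices `i`, `k` have at most `d_i - 1` common neighbours. -/
lemma adjMatrix_sq_add_one_le_degree {V : Type*} [Fintype V] [DecidableEq V]
    (G : SimpleGraph V) [DecidableRel G.Adj] {i k : V} (h : G.Adj i k) :
    (G.adjMatrix ℝ ^ 2) i k + 1 ≤ G.degree i := by
  have hk : k ∈ G.neighborFinset i := by simpa using h
  rw [pow_two, SimpleGraph.adjMatrix_mul_apply, ← Finset.add_sum_erase _ _ hk,
    ← G.card_neighborFinset_eq_degree, ← Finset.card_erase_add_one hk]
  have hle : ∑ j ∈ (G.neighborFinset i).erase k, G.adjMatrix ℝ j k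
      ≤ ∑ _j ∈ (G.neighborFinset i).erase k, (1 : ℝ) := by
    refine Finset.sum_le_sum fun j _ => ?_
    rw [SimpleGraph.adjMatrix_apply]
    split_ifs <;> norm_num
  simp only [Finset.sum_const, nsmul_eq_mul, mul_one] at hle
  simpa using hle

lemma adjMatrix_sq_apply_comm {V : Type*} [Fintype V] [DecidableEq V]
    (G : SimpleGraph V) [DecidableRel G.Adj] (i k : V) :
    (G.adjMatrix ℝ ^ 2) i k = (G.adjMatrix ℝ ^ 2) k i :=
  (((G.isSymm_adjMatrix (α := ℝ)).pow 2).apply i k).symm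

lemma lcpW_apply {N : ℕ} (G : SimpleGraph (Fin N)) [DecidableRel G.Adj] (α δ : ℝ)
    (hd : ∀ i, 0 < G.degree i) (i k : Fin N) :
    lcpW G α δ i k = G.adjMatrix ℝ i k *
      ((α + δ) * ((G.degree i : ℝ)⁻¹ * ((G.adjMatrix ℝ ^ 2) i k + 1) * (G.degree k : ℝ)⁻¹) -
        δ / 2 * ((G.degree i : ℝ)⁻¹ + (G.degree k : ℝ)⁻¹)) := by
  have hinv : (Matrix.diagonal fun i => (G.degree i : ℝ))⁻¹
      = Matrix.diagonal fun i => (G.degree i : ℝ)⁻¹ := by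
    refine Matrix.inv_eq_right_inv ?_
    rw [Matrix.diagonal_mul_diagonal, ← Matrix.diagonal_one]
    congr 1
    funext j
    exact mul_inv_cancel₀ (by exact_mod_cast (hd j).ne')
  simp only [lcpW, hinv, Matrix.sub_apply, Matrix.smul_apply, Matrix.add_apply,
    Matrix.mul_diagonal, Matrix.diagonal_mul, Matrix.hadamard_apply, smul_eq_mul]
  ring

/-- Each entry of `W` is bounded by the corresponding entry of `α·Δ⁻¹·A`. -/
lemma lcpW_apply_le {N : ℕ} (G : SimpleGraph (Fin N)) [DecidableRel G.Adj] {α δ : ℝ}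
    (hd : ∀ i, 0 < G.degree i) (hα : 0 ≤ α) (hδ : 0 ≤ δ) (i k : Fin N) :
    lcpW G α δ i k ≤ G.adjMatrix ℝ i k * (α * (G.degree i : ℝ)⁻¹) := by
  rw [lcpW_apply G α δ hd, SimpleGraph.adjMatrix_apply]
  split_ifs with h
  · have hi := adjMatrix_sq_add_one_le_degree G h
    have hk := adjMatrix_sq_add_one_le_degree G h.symm
    rw [adjMatrix_sq_apply_comm] at hk
    have hdi : (0 : ℝ) < G.degree i := by exact_mod_cast hd i
    have hdk : (0 : ℝ) < G.degree k := by exact_mod_cast hd k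
    generalize (G.adjMatrix ℝ ^ 2) i k = t at hi hk ⊢
    generalize (G.degree i : ℝ) = x at *
    generalize (G.degree k : ℝ) = y at *
    have key : 0 ≤ (α * (y - (t + 1)) + δ * ((x + y) / 2 - (t + 1))) / (x * y) :=
      div_nonneg (add_nonneg (mul_nonneg hα (by linarith)) (mul_nonneg hδ (by linarith)))
        (mul_pos hdi hdk).le
    have hsub : α * x⁻¹ - ((α + δ) * (x⁻¹ * (t + 1) * y⁻¹) - δ / 2 * (x⁻¹ + y⁻¹))
        = (α * (y - (t + 1)) + δ * ((x + y) / 2 - (t + 1))) / (x * y) := by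
      field_simp
      ring
    linarith
  · simp

/-- If `α ≥ 0`, `δ ≥ 0` and `α + (δ/2)·(1 − d_min/d_max) ≤ 1`, then every
off-diagonal row sum of the LCP matrix `W` is at most `1`: `Σ_{k ≠ i} w_{ik} ≤ 1`. -/
theorem stmt_8 {N : ℕ} [NeZero N] (G : SimpleGraph (Fin N)) [DecidableRel G.Adj]
    (α δ : ℝ) (hd : ∀ i, 0 < G.degree i) (hα : 0 ≤ α) (hδ : 0 ≤ δ)
    (hcond : α + δ / 2 *
        (1 - (Finset.univ.inf' Finset.univ_nonempty (fun i => G.degree i) : ℝ) /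
          (Finset.univ.sup' Finset.univ_nonempty (fun i => G.degree i) : ℝ)) ≤ 1) :
    ∀ i : Fin N, ∑ k ∈ Finset.univ.erase i, lcpW G α δ i k ≤ 1 := by
  intro i
  have hdi : (0 : ℝ) < G.degree i := by exact_mod_cast hd i
  have hratio : (Finset.univ.inf' Finset.univ_nonempty (fun i => G.degree i) : ℝ) /
      (Finset.univ.sup' Finset.univ_nonempty (fun i => G.degree i) : ℝ) ≤ 1 := by
    have hinf := Finset.inf'_le (fun i => (G.degree i : ℝ)) (Finset.mem_univ i)
    have hsup := Finset.le_sup' (fun i => (G.degree i : ℝ)) (Finset.mem_univ i)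
    exact (div_le_one (hdi.trans_le hsup)).2 (hinf.trans hsup)
  have hα1 : α ≤ 1 := by
    have := mul_nonneg (div_nonneg hδ zero_le_two) (sub_nonneg.2 hratio)
    linarith
  calc ∑ k ∈ Finset.univ.erase i, lcpW G α δ i k
      ≤ ∑ k ∈ Finset.univ.erase i, G.adjMatrix ℝ i k * (α * (G.degree i : ℝ)⁻¹) :=
        Finset.sum_le_sum fun k _ => lcpW_apply_le G hd hα hδ i k
    _ = ∑ k, G.adjMatrix ℝ i k * (α * (G.degree i : ℝ)⁻¹) :=
        Finset.sum_erase _ (by simp)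
    _ = α := by
        rw [← Finset.sum_mul]
        have hrow : ∑ k, G.adjMatrix ℝ i k = G.degree i := by
          simp [SimpleGraph.adjMatrix_apply, Finset.sum_boole,
            ← G.card_neighborFinset_eq_degree, G.neighborFinset_eq_filter]
        rw [hrow]
        field_simp
    _ ≤ 1 := hα1
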